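/- Let d ≥ 2 and s > d/2 + 1/2. There exists a constant C > 0, depending only on s and d, such that for every t ≥ 0 the following holds. For every L ∈ ℕ and all families (u_ℓ)_{0≤ℓ≤L}, (v_ℓ)_{0≤ℓ≤L}, (w_ℓ)_{0≤ℓ≤2L}, where u_ℓ, v_ℓ and w_ℓ are spherical harmonics of degree ℓ on S^{d−1}, if (Σ_{ℓ=0}^{L} u_ℓ)·(Σ_{ℓ=0}^{L} v_ℓ) = Σ_{ℓ=0}^{2L} w_ℓ pointwise on S^{d−1}, then Σ_{ℓ=0}^{2L} ⟨ℓ⟩^{2s} e^{2(ℓ+(d−2)/2)t} ‖w_ℓ‖²_{L²(S^{d−1})} ≤ C² e^{−(d−2)t} (Σ_{ℓ=0}^{L} ⟨ℓ⟩^{2s} e^{2(ℓ+(d−2)/2)t} ‖u_ℓ‖²_{L²(S^{d−1})})·(Σ_{ℓ=0}^{L} ⟨ℓ⟩^{2s} e^{2(ℓ+(d−2)/2)t} ‖v_ℓ‖²_{L²(S^{d−1})}). -/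

import Mathlib

open MeasureTheory MvPolynomial

/-- Evaluation of a polynomial on `ℝ^d` at a point of the unit sphere. -/
noncomputable def sphereEval {d : ℕ} (p : MvPolynomial (Fin d) ℝ)
    (y : Metric.sphere (0 : EuclideanSpace ℝ (Fin d)) 1) : ℝ :=
  MvPolynomial.eval (fun i => (y : EuclideanSpace ℝ (Fin d)) i) p

/-- `p` is a harmonic polynomial, homogeneous of degree `k`, on `ℝ^d`. -/
def IsHarmHom (d : ℕ) (p : MvPolynomial (Fin d) ℝ) (k : ℕ) : Prop :=
  p.IsHomogeneous k ∧ ∑ i : Fin d, pderiv i (pderiv i p) = 0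

/-- The surface measure on the unit sphere of `ℝ^d`. -/
noncomputable def sphereMeasure (d : ℕ) :
    Measure (Metric.sphere (0 : EuclideanSpace ℝ (Fin d)) 1) :=
  (volume : Measure (EuclideanSpace ℝ (Fin d))).toSphere

/-- The square of the `L²` norm on the unit sphere of the restriction of a polynomial. -/
noncomputable def sphNormSq (d : ℕ) (p : MvPolynomial (Fin d) ℝ) : ℝ :=
  ∫ y : Metric.sphere (0 : EuclideanSpace ℝ (Fin d)) 1,
    (sphereEval p y) ^ 2 ∂(sphereMeasure d)



/-- the integral over the sphere -/
noncomputable def sphI (d : ℕ) (p : MvPolynomial (Fin d) ℝ) : ℝ :=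
  ∫ y, sphereEval p y ∂(sphereMeasure d)

/-- evaluation on the full space -/
noncomputable def fullEval {d : ℕ} (p : MvPolynomial (Fin d) ℝ) (x : EuclideanSpace ℝ (Fin d)) : ℝ :=
  MvPolynomial.eval (fun i => x i) p

lemma fullEval_continuous {d : ℕ} (p : MvPolynomial (Fin d) ℝ) : Continuous (fullEval p) := by
  unfold fullEval
  exact (MvPolynomial.continuous_eval p).comp (by fun_prop)

lemma sphereEval_continuous {d : ℕ} (p : MvPolynomial (Fin d) ℝ) : Continuous (sphereEval p) :=
  (fullEval_continuous p).comp continuous_subtype_val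

instance sphereMeasure_finite (d : ℕ) : IsFiniteMeasure (sphereMeasure d) := by
  unfold sphereMeasure; infer_instance

lemma sphere_integrable {d : ℕ} {f : Metric.sphere (0 : EuclideanSpace ℝ (Fin d)) 1 → ℝ}
    (hf : Continuous f) : Integrable f (sphereMeasure d) :=
  hf.integrable_of_hasCompactSupport (HasCompactSupport.of_compactSpace f)

lemma fullEval_smul {d m : ℕ} {p : MvPolynomial (Fin d) ℝ} (hp : p.IsHomogeneous m) (r : ℝ)
    (x : EuclideanSpace ℝ (Fin d)) : fullEval p (r • x) = r ^ m * fullEval p x := by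
  unfold fullEval
  simp only [MvPolynomial.eval_eq', Finset.mul_sum]
  refine Finset.sum_congr rfl fun a ha => ?_
  have h1 : ∑ i, a i = m := by
    have := hp (by simpa using ha)
    rw [← this]; simp [Finsupp.weight_apply, Finsupp.sum_fintype]
  simp only [PiLp.smul_apply, smul_eq_mul, mul_pow, Finset.prod_mul_distrib,
    Finset.prod_pow_eq_pow_sum, h1]
  ring

lemma fullEval_line {d : ℕ} (p : MvPolynomial (Fin d) ℝ) (i : Fin d) (x : EuclideanSpace ℝ (Fin d)) :
    HasLineDerivAt ℝ (fullEval p) (fullEval (pderiv i p) x) x (EuclideanSpace.single i 1) := by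
  unfold HasLineDerivAt
  induction p using MvPolynomial.induction_on with
  | C a => simpa [fullEval] using hasDerivAt_const _ _
  | add p q hp hq =>
    have := hp.add hq
    simp only [fullEval, map_add] at this ⊢
    exact this
  | mul_X p j hp =>
    have h2 : HasDerivAt (fun t : ℝ => (x + t • EuclideanSpace.single i (1:ℝ)) j)
        (if j = i then 1 else 0) 0 := by
      have : (fun t : ℝ => (x + t • EuclideanSpace.single i (1:ℝ)) j) =
        fun t => x j + t * (if j = i then 1 else 0) := by
        funext t; simp
      rw [this]
      simpa using ((hasDerivAt_id (0:ℝ)).mul_const (if j = i then (1:ℝ) else 0)).const_add (x j)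
    have := hp.mul h2
    simp only [fullEval, map_mul, eval_X, pderiv_mul, map_add, pderiv_X] at this ⊢
    convert! this using 1
    by_cases h : j = i
    · subst h; simp
    · simp [h]

lemma radial_integrable (n m : ℕ) :
    Integrable (fun r : Set.Ioi (0:ℝ) => (r:ℝ) ^ m * Real.exp (-(r:ℝ)^2)) (Measure.volumeIoiPow n) := by
  rw [Measure.volumeIoiPow, integrable_withDensity_iff_integrable_smul' (by fun_prop) (by simp)]
  have h := integrableOn_rpow_mul_exp_neg_mul_sq (b := 1) one_pos (s := ((n + m : ℕ) : ℝ)) (by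
    have : (0:ℝ) ≤ ((n + m : ℕ) : ℝ) := Nat.cast_nonneg _
    linarith)
  rw [integrableOn_iff_comap_subtypeVal measurableSet_Ioi] at h
  refine h.congr (Filter.Eventually.of_forall ?_)
  rintro ⟨x, hx : 0 < x⟩
  have : 0 ≤ x ^ n := by positivity
  simp only [Function.comp, smul_eq_mul, Real.rpow_natCast, ENNReal.toReal_ofReal this]
  rw [pow_add]; simp; ring

/-- radial constant -/
noncomputable def radC (n m : ℕ) : ℝ :=
  ∫ r : Set.Ioi (0:ℝ), (r:ℝ) ^ m * Real.exp (-(r:ℝ)^2) ∂(Measure.volumeIoiPow n)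

lemma radC_eq (n m : ℕ) : radC n m = 1/2 * Real.Gamma (((n + m : ℕ) + 1 : ℝ)/2) := by
  have h := integral_rpow_mul_exp_neg_rpow (p := 2) (q := ((n+m : ℕ):ℝ)) two_pos (by
    have : (0:ℝ) ≤ ((n + m : ℕ) : ℝ) := Nat.cast_nonneg _
    linarith)
  rw [← h, radC, Measure.volumeIoiPow]
  rw [integral_withDensity_eq_integral_toReal_smul (by fun_prop) (by simp)]
  rw [← integral_subtype_comap measurableSet_Ioi]
  refine integral_congr_ae (Filter.Eventually.of_forall ?_)
  rintro ⟨x, hx : 0 < x⟩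
  have : 0 ≤ x ^ n := by positivity
  simp only [smul_eq_mul, Real.rpow_natCast, ENNReal.toReal_ofReal this, Real.rpow_two]
  rw [pow_add]; ring

lemma radC_pos (n m : ℕ) : 0 < radC n m := by
  rw [radC_eq]
  have := Real.Gamma_pos_of_pos (s := ((n + m : ℕ) + 1 : ℝ)/2) (by positivity)
  positivity

lemma radC_succ (n m : ℕ) : radC n (m+2) = ((n + m : ℕ) + 1 : ℝ)/2 * radC n m := by
  rw [radC_eq, radC_eq]
  have : (((n + (m+2) : ℕ) + 1 : ℝ)/2) = ((n + m : ℕ) + 1 : ℝ)/2 + 1 := by push_cast; ring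
  rw [this, Real.Gamma_add_one (by positivity)]
  ring

lemma polar {d m : ℕ} (hd : 1 ≤ d) {p : MvPolynomial (Fin d) ℝ} (hp : p.IsHomogeneous m) :
    Integrable (fun x => fullEval p x * Real.exp (-‖x‖^2)) ∧
    ∫ x, fullEval p x * Real.exp (-‖x‖^2) = sphI d p * radC (d-1) m := by
  have : Nonempty (Fin d) := ⟨⟨0, hd⟩⟩
  set E := EuclideanSpace ℝ (Fin d)
  have mp := (volume : Measure E).measurePreserving_homeomorphUnitSphereProd
  have hdim : Module.finrank ℝ E = d := by simp [E]
  rw [hdim] at mp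
  set G : Metric.sphere (0:E) 1 × Set.Ioi (0:ℝ) → ℝ :=
    fun z => sphereEval p z.1 * ((z.2:ℝ)^m * Real.exp (-(z.2:ℝ)^2)) with hG
  have hGi : Integrable G ((volume : Measure E).toSphere.prod (Measure.volumeIoiPow (d-1))) :=
    (sphere_integrable (sphereEval_continuous p)).mul_prod (radial_integrable (d-1) m)
  have hcomp : ∀ x : ({(0:E)}ᶜ : Set E), G (homeomorphUnitSphereProd E x) =
      fullEval p x.1 * Real.exp (-‖x.1‖^2) := by
    intro x
    have hx : x.1 = ‖x.1‖ • ((homeomorphUnitSphereProd E x).1 : E) := by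
      have h0 : ‖x.1‖ ≠ 0 := norm_ne_zero_iff.2 x.2
      simp [smul_smul, h0]
    have h1 : fullEval p x.1 = ‖x.1‖^m * sphereEval p (homeomorphUnitSphereProd E x).1 := by
      conv_lhs => rw [hx]
      rw [fullEval_smul hp]; rfl
    simp only [hG, homeomorphUnitSphereProd_apply_snd_coe, h1]
    ring
  have emb := (homeomorphUnitSphereProd E).measurableEmbedding
  constructor
  · rw [← mp.integrable_comp_emb emb] at hGi
    rw [← restrict_compl_singleton (μ := (volume : Measure E)) 0, ← IntegrableOn,
      integrableOn_iff_comap_subtypeVal (by measurability)]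
    refine hGi.congr (Filter.Eventually.of_forall fun x => hcomp x)
  · have h2 := mp.integral_comp emb G
    rw [integral_prod_mul (f := sphereEval p) (g := fun r : Set.Ioi (0:ℝ) => (r:ℝ)^m * Real.exp (-(r:ℝ)^2))] at h2
    rw [sphI, radC, sphereMeasure, ← h2]
    simp only [hcomp]
    rw [integral_subtype_comap (measurableSet_singleton _).compl
      fun x : E ↦ fullEval p x * Real.exp (-‖x‖^2), restrict_compl_singleton]

lemma gauss_line {d : ℕ} (i : Fin d) (x : EuclideanSpace ℝ (Fin d)) :
    HasLineDerivAt ℝ (fun x : EuclideanSpace ℝ (Fin d) => Real.exp (-‖x‖^2))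
      (-(2 * x i) * Real.exp (-‖x‖^2)) x (EuclideanSpace.single i 1) := by
  have h : HasFDerivAt (fun x : EuclideanSpace ℝ (Fin d) => Real.exp (-‖x‖^2)) _ x :=
    ((hasStrictFDerivAt_norm_sq x).hasFDerivAt.neg).exp
  convert! h.hasLineDerivAt (EuclideanSpace.single i 1) using 1
  simp [EuclideanSpace.inner_single_right]
  ring

lemma sphI_pderiv {d m : ℕ} (hd : 1 ≤ d) {p : MvPolynomial (Fin d) ℝ} (hp : p.IsHomogeneous m)
    (i : Fin d) : sphI d (pderiv i p) = (m + d - 1 : ℝ) * sphI d (X i * p) := by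
  obtain ⟨i0, e0⟩ := polar hd hp
  obtain ⟨i1, e1⟩ := polar hd (hp.pderiv (i := i))
  obtain ⟨i2, e2⟩ := polar hd ((isHomogeneous_X ℝ i).mul hp)
  have h := integral_bilinear_hasLineDerivAt_right_eq_neg_left_of_integrable (μ := volume)
    (B := ContinuousLinearMap.mul ℝ ℝ) (f := fullEval p) (f' := fullEval (pderiv i p))
    (g := fun x : EuclideanSpace ℝ (Fin d) => Real.exp (-‖x‖^2))
    (g' := fun x => (-(2 * x i) * Real.exp (-‖x‖^2))) (v := EuclideanSpace.single i 1)
    (by simpa using i1) (by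
      convert i2.const_mul (-2) using 2 with x
      simp [fullEval]; ring) (by simpa using i0)
    (fun x _ => fullEval_line p i x) (fun x _ => gauss_line i x)
  have h3 : ∫ x, (ContinuousLinearMap.mul ℝ ℝ) (fullEval p x) (-(2 * x i) * Real.exp (-‖x‖^2)) =
      (-2) * ∫ x, fullEval (X i * p) x * Real.exp (-‖x‖^2) := by
    rw [← integral_const_mul]
    congr 1; funext x
    simp [fullEval]; ring
  rw [h3] at h
  simp only [ContinuousLinearMap.mul_apply'] at h
  rw [e1, e2] at h
  obtain ⟨e, rfl⟩ : ∃ e, d = e + 1 := ⟨d-1, by omega⟩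
  rcases m with _ | m
  · have : pderiv i p = 0 := by
      have h0 : p.totalDegree = 0 := by
        have := hp.totalDegree_le
        omega
      rw [totalDegree_eq_zero_iff_eq_C] at h0
      rw [h0, pderiv_C]
    have hr := radC_pos e 1
    have hz : sphI (e+1) (0 : MvPolynomial (Fin (e+1)) ℝ) = 0 := by simp [sphI, sphereEval]
    rw [this, hz] at h ⊢
    simp only [Nat.add_sub_cancel, zero_mul, neg_zero, Nat.add_zero] at h
    have : sphI (e+1) (X i * p) = 0 := by
      rcases mul_eq_zero.1 h with h | h
      · norm_num at h
      · exact (mul_eq_zero.1 h).resolve_right hr.ne'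
    rw [this, mul_zero]
  · have : 1 + (m+1) = m + 2 := by ring
    rw [this, radC_succ] at h
    simp only [Nat.add_sub_cancel] at h
    have hr := radC_pos e m
    push_cast at h ⊢
    have : radC e m * (sphI (e+1) (pderiv i p) - ((m+1+(e+1)-1) * sphI (e+1) (X i * p))) = 0 := by
      linear_combination h
    rcases mul_eq_zero.1 this with h | h
    · exact absurd h hr.ne'
    · linarith


section algebra
variable {d : ℕ}

lemma sphI_add (p q : MvPolynomial (Fin d) ℝ) : sphI d (p + q) = sphI d p + sphI d q := by
  unfold sphI
  rw [← integral_add (sphere_integrable (sphereEval_continuous p)) (sphere_integrable (sphereEval_continuous q))]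
  simp [sphereEval]

lemma sphI_smul (c : ℝ) (p : MvPolynomial (Fin d) ℝ) : sphI d (c • p) = c * sphI d p := by
  unfold sphI
  rw [← integral_const_mul]
  simp [sphereEval]

/-- linear version -/
noncomputable def sphIL (d : ℕ) : MvPolynomial (Fin d) ℝ →ₗ[ℝ] ℝ where
  toFun := sphI d
  map_add' := sphI_add
  map_smul' := sphI_smul

lemma sphI_sum {ι : Type*} (s : Finset ι) (f : ι → MvPolynomial (Fin d) ℝ) :
    sphI d (∑ i ∈ s, f i) = ∑ i ∈ s, sphI d (f i) := map_sum (sphIL d) f s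

lemma sphI_sub (p q : MvPolynomial (Fin d) ℝ) : sphI d (p - q) = sphI d p - sphI d q :=
  map_sub (sphIL d) p q

lemma sphI_zero : sphI d 0 = 0 := map_zero (sphIL d)

lemma sphNormSq_eq (p : MvPolynomial (Fin d) ℝ) : sphNormSq d p = sphI d (p * p) := by
  simp [sphNormSq, sphI, sphereEval, sq]

lemma sphI_pos (hd : 1 ≤ d) {k : ℕ} {p : MvPolynomial (Fin d) ℝ} (hp : p.IsHomogeneous k)
    (h : sphI d (p * p) = 0) : p = 0 := by
  obtain ⟨i, e⟩ := polar hd (hp.mul hp)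
  rw [h, zero_mul] at e
  have hc : Continuous fun x => fullEval (p * p) x * Real.exp (-‖x‖^2) :=
    (fullEval_continuous _).mul (by fun_prop)
  rw [integral_eq_zero_iff_of_nonneg (fun x => by
    simp only [fullEval, map_mul, Pi.zero_apply]
    exact mul_nonneg (mul_self_nonneg _) (Real.exp_pos _).le) i,
    Continuous.ae_eq_iff_eq _ hc continuous_zero] at e
  apply MvPolynomial.funext
  intro x
  have := congrFun e (WithLp.toLp 2 x)
  simpa [fullEval, Real.exp_ne_zero] using this

lemma pd_comm (a b : Fin d) (q : MvPolynomial (Fin d) ℝ) :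
    pderiv a (pderiv b q) = pderiv b (pderiv a q) := by
  by_cases hab : a = b
  · rw [hab]
  have hba : b ≠ a := fun h => hab h.symm
  ext m
  simp only [coeff_pderiv]
  rw [add_right_comm]
  simp [Finsupp.single_apply, hab, hba]
  ring

lemma harm_pderiv {P : MvPolynomial (Fin d) ℝ} {k : ℕ} (h : IsHarmHom d P k) (i : Fin d) :
    IsHarmHom d (pderiv i P) (k-1) := by
  refine ⟨h.1.pderiv, ?_⟩
  have h2 := congrArg (pderiv i) h.2
  rw [map_sum, map_zero] at h2
  rw [← h2]
  refine Finset.sum_congr rfl fun j _ => ?_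
  rw [pd_comm j i, pd_comm j i]

lemma green (hd : 2 ≤ d) {P q : MvPolynomial (Fin d) ℝ} {k n : ℕ} (h : IsHarmHom d P k)
    (hq : q.IsHomogeneous n) (hk : 1 ≤ k) :
    (k + n + d - 2 : ℝ) * (k * sphI d (P * q)) = ∑ i, sphI d (pderiv i P * pderiv i q) := by
  have e1 : (k:ℝ) * sphI d (P * q) = ∑ i, sphI d (X i * (pderiv i P * q)) := by
    rw [← sphI_sum, ← sphI_smul]
    congr 1
    have := congrArg (· * q) h.1.sum_X_mul_pderiv
    simp only [Finset.sum_mul] at this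
    simp only [← mul_assoc, this]
    rw [← smul_mul_assoc, Nat.cast_smul_eq_nsmul]
  have e2 : ∀ i, (k + n + d - 2 : ℝ) * sphI d (X i * (pderiv i P * q)) =
      sphI d (pderiv i (pderiv i P) * q) + sphI d (pderiv i P * pderiv i q) := by
    intro i
    have := sphI_pderiv (by omega) ((h.1.pderiv (i := i)).mul hq) i
    rw [pderiv_mul, sphI_add] at this
    rw [this]
    push_cast [hk]
    ring
  rw [e1, Finset.mul_sum, Finset.sum_congr rfl fun i _ => e2 i, Finset.sum_add_distrib, ← sphI_sum,
    ← Finset.sum_mul, h.2, zero_mul, sphI_zero, zero_add]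

lemma harm_orth (hd : 2 ≤ d) (n : ℕ) : ∀ (k : ℕ) (P q : MvPolynomial (Fin d) ℝ), IsHarmHom d P k →
    q.IsHomogeneous n → n < k → sphI d (P * q) = 0 := by
  induction n with
  | zero =>
    intro k P q h hq hk
    have g := green hd h hq hk
    have h0 : q.totalDegree = 0 := by
      have := hq.totalDegree_le
      omega
    rw [totalDegree_eq_zero_iff_eq_C] at h0
    have hz : ∀ i, pderiv i q = 0 := fun i => by rw [h0, pderiv_C]
    simp only [hz, mul_zero, sphI_zero, Finset.sum_const_zero] at g
    have h1 : (1:ℝ) ≤ k := by exact_mod_cast hk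
    have h2 : (2:ℝ) ≤ d := by exact_mod_cast hd
    have : (k + (0:ℕ) + d - 2 : ℝ) ≠ 0 := by push_cast; intro; linarith
    have h3 := (mul_eq_zero.1 g).resolve_left this
    exact (mul_eq_zero.1 h3).resolve_left (by intro; linarith)
  | succ n ih =>
    intro k P q h hq hk
    have g := green hd h hq (by omega)
    have hz : ∀ i, sphI d (pderiv i P * pderiv i q) = 0 := fun i =>
      ih (k-1) _ _ (harm_pderiv h i) (hq.pderiv (i := i)) (by omega)
    simp only [hz, Finset.sum_const_zero] at g
    have h1 : (1:ℝ) ≤ k := by exact_mod_cast (by omega : 1 ≤ k)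
    have h2 : (2:ℝ) ≤ d := by exact_mod_cast hd
    have : (k + (n+1:ℕ) + d - 2 : ℝ) ≠ 0 := by
      push_cast; intro; have : (0:ℝ) ≤ n := Nat.cast_nonneg _
      linarith
    have h3 := (mul_eq_zero.1 g).resolve_left this
    exact (mul_eq_zero.1 h3).resolve_left (by intro; linarith)

/-- rotation vector field -/
noncomputable def rotF (a b : Fin d) (P : MvPolynomial (Fin d) ℝ) : MvPolynomial (Fin d) ℝ :=
  X a * pderiv b P - X b * pderiv a P

lemma rotF_mul (a b : Fin d) (P Q : MvPolynomial (Fin d) ℝ) :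
    rotF a b (P * Q) = rotF a b P * Q + P * rotF a b Q := by
  simp only [rotF, pderiv_mul]; ring

lemma rotF_sum {ι : Type*} (s : Finset ι) (a b : Fin d) (P : ι → MvPolynomial (Fin d) ℝ) :
    rotF a b (∑ i ∈ s, P i) = ∑ i ∈ s, rotF a b (P i) := by
  simp only [rotF, map_sum, Finset.mul_sum, Finset.sum_sub_distrib]

lemma sphI_rotF (hd : 2 ≤ d) (a b : Fin d) {P : MvPolynomial (Fin d) ℝ} {k : ℕ}
    (h : P.IsHomogeneous k) : sphI d (rotF a b P) = 0 := by
  have e : rotF a b P = pderiv b (X a * P) - pderiv a (X b * P) := by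
    simp only [rotF, pderiv_mul, pderiv_X]
    by_cases hab : a = b
    · subst hab; simp
    · have hba : b ≠ a := fun h => hab h.symm
      simp [Pi.single_apply, hab, hba]
  rw [e, sphI_sub, sphI_pderiv (by omega) ((isHomogeneous_X ℝ a).mul h),
    sphI_pderiv (by omega) ((isHomogeneous_X ℝ b).mul h)]
  rw [mul_left_comm, sub_self]

lemma pd_zero {P : MvPolynomial (Fin d) ℝ} (h : P.IsHomogeneous 0) (i : Fin d) :
    pderiv i P = 0 := by
  have h0 : P.totalDegree = 0 := by
    have := h.totalDegree_le
    omega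
  rw [totalDegree_eq_zero_iff_eq_C] at h0
  rw [h0, pderiv_C]

lemma harm_rotF (a b : Fin d) {P : MvPolynomial (Fin d) ℝ} {k : ℕ}
    (h : IsHarmHom d P k) : IsHarmHom d (rotF a b P) k := by
  constructor
  · rcases k with _ | k
    · simp only [rotF, pd_zero h.1, mul_zero, sub_zero]
      exact isHomogeneous_zero _ _ _
    · have h1 : ∀ a b : Fin d, (X a * pderiv b P).IsHomogeneous (k+1) := fun a b => by
        have := (isHomogeneous_X ℝ a).mul (h.1.pderiv (i := b))
        rwa [show 1 + (k+1-1) = k+1 by omega] at this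
      exact (h1 a b).sub (h1 b a)
  · have key : ∀ a b : Fin d, ∑ i, pderiv i (pderiv i (X a * pderiv b P)) = 2 * pderiv a (pderiv b P) := by
      intro a b
      have e : ∀ i, pderiv i (pderiv i (X a * pderiv b P)) =
          (if i = a then 2 * pderiv a (pderiv b P) else 0) + X a * pderiv i (pderiv i (pderiv b P)) := by
        intro i
        by_cases hi : i = a
        · subst hi
          simp [pderiv_mul]; ring
        · have : a ≠ i := fun h => hi h.symm
          simp [pderiv_mul, pderiv_X_of_ne this, hi]
      rw [Finset.sum_congr rfl fun i _ => e i, Finset.sum_add_distrib, ← Finset.mul_sum,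
        (harm_pderiv h b).2]
      simp
    simp only [rotF, map_sub, Finset.sum_sub_distrib, key]
    rw [pd_comm a b, sub_self]

/-- squared radius -/
noncomputable def rsq (d : ℕ) : MvPolynomial (Fin d) ℝ := ∑ i, X i * X i

lemma rsq_ne (hd : 1 ≤ d) : rsq d ≠ 0 := by
  intro h
  have := congrArg (MvPolynomial.eval (fun _ => (1:ℝ))) h
  simp [rsq] at this
  omega

lemma pd_rsq (i : Fin d) : pderiv i (rsq d) = 2 * X i := by
  simp only [rsq, map_sum, pderiv_mul, pderiv_X, Pi.single_apply]
  simp [Finset.sum_add_distrib]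
  ring

lemma rot_inv (hd : 2 ≤ d) (k : ℕ) : ∀ N : MvPolynomial (Fin d) ℝ, N.IsHomogeneous (2 * k) →
    (∀ a b, X a * pderiv b N = X b * pderiv a N) → ∃ c : ℝ, N = C c * rsq d ^ k := by
  induction k with
  | zero =>
    intro N hN _
    have h0 : N.totalDegree = 0 := by
      have := hN.totalDegree_le
      omega
    rw [totalDegree_eq_zero_iff_eq_C] at h0
    exact ⟨_, by rw [pow_zero, mul_one]; exact h0⟩
  | succ k ih =>
    intro N hN hr
    set D := ∑ i, pderiv i (pderiv i N) with hD
    have e1 : ∀ b, X b * D = (d + 2 * k : ℝ) • pderiv b N := by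
      intro b
      have h1 : ∑ a, pderiv a (X a * pderiv b N) = ∑ a, pderiv a (X b * pderiv a N) :=
        Finset.sum_congr rfl fun a _ => by rw [hr a b]
      have h2 := (hN.pderiv (i := b)).sum_X_mul_pderiv
      simp only [pderiv_mul, pderiv_X_self, Finset.sum_add_distrib, one_mul, h2] at h1
      simp only [pderiv_X, Pi.single_apply, ite_mul, one_mul, zero_mul, ← Finset.mul_sum] at h1
      simp at h1
      rw [← hD] at h1
      rw [smul_eq_C_mul]
      push_cast [map_add, map_mul, map_natCast, map_ofNat] at h1 ⊢
      linear_combination -h1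
    have e2 : rsq d * D = ((d + 2 * k) * (2 * k + 2) : ℝ) • N := by
      have h2 := hN.sum_X_mul_pderiv
      rw [rsq, Finset.sum_mul]
      simp only [mul_assoc, e1, mul_smul_comm, ← Finset.smul_sum, h2]
      rw [← Nat.cast_smul_eq_nsmul ℝ, smul_smul]
      push_cast; ring_nf
    have h2 : (2:ℝ) ≤ d := by exact_mod_cast hd
    have hpos : ((d + 2 * k) * (2 * k + 2) : ℝ) ≠ 0 := by positivity
    set M := ((d + 2 * k) * (2 * k + 2) : ℝ)⁻¹ • D with hM
    have e3 : N = rsq d * M := by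
      rw [hM, mul_smul_comm, e2, smul_smul, inv_mul_cancel₀ hpos, one_smul]
    have hDh : D.IsHomogeneous (2 * k) := by
      refine IsHomogeneous.sum _ _ _ fun i _ => ?_
      have := (hN.pderiv (i := i)).pderiv (i := i)
      rwa [show 2 * (k+1) - 1 - 1 = 2 * k by omega] at this
    have hMh : M.IsHomogeneous (2 * k) := (homogeneousSubmodule (Fin d) ℝ (2*k)).smul_mem _ hDh
    obtain ⟨c, hc⟩ := ih M hMh (fun a b => by
      have := hr a b
      rw [e3, pderiv_mul, pderiv_mul, pd_rsq, pd_rsq] at this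
      apply mul_left_cancel₀ (rsq_ne (by omega : 1 ≤ d))
      linear_combination this)
    exact ⟨c, by rw [e3, hc]; ring⟩

end algebra


/-- space of harmonic polynomials -/
def harmSub (d k : ℕ) : Submodule ℝ (MvPolynomial (Fin d) ℝ) where
  carrier := {P | IsHarmHom d P k}
  add_mem' := by
    rintro a b ⟨h1, h2⟩ ⟨h3, h4⟩
    exact ⟨h1.add h3, by simp only [map_add, Finset.sum_add_distrib, h2, h4, add_zero]⟩
  zero_mem' := ⟨isHomogeneous_zero _ _ _, by simp⟩
  smul_mem' := by
    rintro c a ⟨h1, h2⟩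
    refine ⟨(homogeneousSubmodule (Fin d) ℝ k).smul_mem _ h1, ?_⟩
    simp only [Derivation.map_smul, ← Finset.smul_sum, h2, smul_zero]

/-- exponents -/
noncomputable def harmIdx {n : ℕ} (k : ℕ) (z : Fin 2 × (Fin n → Fin (k+1))) : Fin (n+2) →₀ ℕ :=
  Finsupp.equivFunOnFinite.symm
    (Fin.cons (z.1 : ℕ) (Fin.cons (k - z.1 - ∑ i, (z.2 i : ℕ)) (fun i => (z.2 i : ℕ))))

/-- coefficients -/
noncomputable def harmMap (n k : ℕ) :
    harmSub (n+2) k →ₗ[ℝ] (Fin 2 × (Fin n → Fin (k+1)) → ℝ) where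
  toFun P z := coeff (harmIdx k z) P.1
  map_add' P Q := by ext z; simp
  map_smul' c P := by ext z; simp

lemma harm_coeff_zero {n k : ℕ} {P : MvPolynomial (Fin (n+2)) ℝ} (h : IsHarmHom (n+2) P k)
    (h0 : ∀ z : Fin 2 × (Fin n → Fin (k+1)), coeff (harmIdx k z) P = 0) :
    ∀ (m : ℕ) (α : Fin (n+2) →₀ ℕ), α 0 = m → coeff α P = 0 := by
  intro m
  induction m using Nat.strong_induction_on with
  | _ m ih =>
    intro α hα
    by_contra hne
    have hsum : ∑ i, α i = k := by
      have := h.1 hne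
      rw [← this]; simp [Finsupp.weight_apply, Finsupp.sum_fintype]
    rcases Nat.lt_or_ge m 2 with hm | hm
    · apply hne
      have hle : ∀ i, α i < k + 1 := fun i => by
        have := Finset.single_le_sum (f := fun i => α i) (fun i _ => Nat.zero_le _) (Finset.mem_univ i)
        rw [hsum] at this
        exact Nat.lt_succ_of_le this
      rw [← h0 (⟨m, hm⟩, fun i => ⟨α i.succ.succ, hle _⟩)]
      congr 1
      ext i
      simp only [harmIdx]
      rw [Fin.sum_univ_succ, Fin.sum_univ_succ] at hsum
      refine Fin.cases ?_ (fun j => Fin.cases ?_ (fun l => ?_) j) i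
      · simpa using hα
      · simp
        simp at hsum
        omega
      · simp
    · obtain ⟨γ, rfl⟩ : ∃ γ : Fin (n+2) →₀ ℕ, α = γ + Finsupp.single 0 1 + Finsupp.single 0 1 := by
        refine ⟨α - (Finsupp.single 0 1 + Finsupp.single 0 1), ?_⟩
        rw [add_assoc, tsub_add_cancel_of_le]
        intro i
        by_cases hi : i = 0
        · subst hi; simp; omega
        · have : (0 : Fin (n+2)) ≠ i := fun h => hi h.symm
          simp [this]
      have h2 := congrArg (coeff γ) h.2
      simp only [coeff_sum, coeff_pderiv, coeff_zero] at h2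
      rw [Finset.sum_eq_single 0 (fun i _ hi => by
        rw [ih (γ 0) (by simp at hα; omega) (γ + Finsupp.single i 1 + Finsupp.single i 1) (by simp [hi])]
        ring) (by simp)] at h2
      rcases mul_eq_zero.1 h2 with h2 | h2
      · rcases mul_eq_zero.1 h2 with h2 | h2
        · exact hne h2
        · have : (0:ℝ) ≤ (((γ + Finsupp.single 0 1 : Fin (n+2) →₀ ℕ) 0 : ℕ) : ℝ) := Nat.cast_nonneg _
          linarith
      · have : (0:ℝ) ≤ (γ 0 : ℕ) := Nat.cast_nonneg _
        linarith

lemma harmMap_inj (n k : ℕ) : Function.Injective (harmMap n k) := by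
  rw [← LinearMap.ker_eq_bot, LinearMap.ker_eq_bot']
  rintro ⟨P, hP⟩ h
  ext α
  exact harm_coeff_zero hP (fun z => congrFun h z) _ α rfl

instance harm_fin (n k : ℕ) : FiniteDimensional ℝ (harmSub (n+2) k) :=
  FiniteDimensional.of_injective _ (harmMap_inj n k)

lemma harm_finrank (n k : ℕ) : Module.finrank ℝ (harmSub (n+2) k) ≤ 2 * (k+1)^n := by
  have := LinearMap.finrank_le_finrank_of_injective (harmMap_inj n k)
  simpa using this

/-- inner product -/
@[reducible]
noncomputable def harmCore (n k : ℕ) : InnerProductSpace.Core ℝ (harmSub (n+2) k) where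
  inner P Q := sphI (n+2) (P.1 * Q.1)
  conj_inner_symm P Q := by simp [mul_comm]
  re_inner_nonneg P := by
    simp only [RCLike.re_to_real, ← sphNormSq_eq]
    exact integral_nonneg fun y => sq_nonneg _
  add_left P Q R := by simp [add_mul, sphI_add]
  smul_left P Q c := by simp [sphI_smul]
  definite P h := by
    ext1
    exact sphI_pos (by omega) P.2.1 h

lemma harm_basis (n k : ℕ) : ∃ (N : ℕ) (e : Fin N → MvPolynomial (Fin (n+2)) ℝ), N ≤ 2 * (k+1)^n ∧
    (∀ i, IsHarmHom (n+2) (e i) k) ∧ (∀ i, sphI (n+2) (e i * e i) = 1) ∧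
    ∀ P, IsHarmHom (n+2) P k → (P = ∑ i, sphI (n+2) (e i * P) • e i ∧
      ∑ i, sphI (n+2) (e i * P) ^ 2 = sphI (n+2) (P * P)) := by
  let : NormedAddCommGroup (harmSub (n+2) k) := (harmCore n k).toNormedAddCommGroup
  let : InnerProductSpace ℝ (harmSub (n+2) k) := InnerProductSpace.ofCore (harmCore n k).toCore
  have hin : ∀ P Q : harmSub (n+2) k, inner ℝ P Q = sphI (n+2) (P.1 * Q.1) := fun P Q => rfl
  let b := stdOrthonormalBasis ℝ (harmSub (n+2) k)
  refine ⟨_, fun i => (b i).1, harm_finrank n k, fun i => (b i).2, fun i => ?_, fun P hP => ⟨?_, ?_⟩⟩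
  · rw [← hin, b.inner_eq_one]
  · have := congrArg Subtype.val (b.sum_repr' ⟨P, hP⟩)
    simp only [hin] at this
    refine this.symm.trans ?_
    simp
  · have := b.sum_sq_inner_right ⟨P, hP⟩
    rw [← real_inner_self_eq_norm_sq] at this
    simpa only [hin] using this

lemma sup_bound (n k : ℕ) {P : MvPolynomial (Fin (n+2)) ℝ} (hP : IsHarmHom (n+2) P k)
    (y : Metric.sphere (0 : EuclideanSpace ℝ (Fin (n+2))) 1) :
    sphI (n+2) 1 * sphereEval P y ^ 2 ≤ 2 * (k+1)^n * sphI (n+2) (P * P) := by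
  obtain ⟨N, e, hN, he, h1, hb⟩ := harm_basis n k
  have hQ : (∑ i, e i * e i).IsHomogeneous (2 * k) := by
    refine IsHomogeneous.sum _ _ _ fun i _ => ?_
    have := (he i).1.mul (he i).1
    rwa [← two_mul] at this
  have hrot : ∀ a b, rotF a b (∑ i, e i * e i) = 0 := by
    intro a b
    have h2 : ∀ i, rotF a b (e i) = ∑ j, sphI (n+2) (e j * rotF a b (e i)) • e j :=
      fun i => (hb _ (harm_rotF a b (he i))).1
    have h3 : ∀ i j, sphI (n+2) (e j * rotF a b (e i)) = - sphI (n+2) (e i * rotF a b (e j)) := by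
      intro i j
      have := sphI_rotF (by omega) a b ((he i).1.mul (he j).1)
      rw [rotF_mul, sphI_add, mul_comm (rotF a b (e i))] at this
      linarith
    have h4 : ∑ i, rotF a b (e i) * e i = - ∑ i, rotF a b (e i) * e i := by
      calc ∑ i, rotF a b (e i) * e i
          = ∑ i, ∑ j, sphI (n+2) (e j * rotF a b (e i)) • (e j * e i) := by
            refine Finset.sum_congr rfl fun i _ => ?_
            conv_lhs => rw [h2 i]
            simp only [Finset.sum_mul, smul_mul_assoc]
        _ = ∑ j, ∑ i, sphI (n+2) (e j * rotF a b (e i)) • (e j * e i) := Finset.sum_comm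
        _ = ∑ j, ∑ i, -(sphI (n+2) (e i * rotF a b (e j)) • (e i * e j)) := by
            refine Finset.sum_congr rfl fun i _ => Finset.sum_congr rfl fun j _ => ?_
            rw [h3, neg_smul, mul_comm (e i) (e j)]
        _ = - ∑ i, rotF a b (e i) * e i := by
            simp only [Finset.sum_neg_distrib]
            congr 1
            refine Finset.sum_congr rfl fun i _ => ?_
            conv_rhs => rw [h2 i]
            simp only [Finset.sum_mul, smul_mul_assoc]
    have h5 : ∑ i, rotF a b (e i) * e i = 0 := self_eq_neg.1 h4
    rw [rotF_sum]
    simp only [rotF_mul]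
    rw [Finset.sum_add_distrib, h5]
    simp only [mul_comm (e _)]
    rw [h5, add_zero]
  obtain ⟨c, hc⟩ := rot_inv (by omega) k _ hQ (fun a b => sub_eq_zero.1 (hrot a b))
  have hr : ∀ y, sphereEval (rsq (n+2)) y = 1 := by
    intro y
    have := y.2
    rw [mem_sphere_zero_iff_norm, EuclideanSpace.norm_eq, Real.sqrt_eq_one] at this
    simp only [Real.norm_eq_abs, sq_abs] at this
    simp only [sphereEval, rsq, map_sum, map_mul, eval_X]
    exact (Finset.sum_congr rfl fun i _ => (sq _).symm).trans this
  have hc' : ∀ y, sphereEval (∑ i, e i * e i) y = c := by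
    intro y
    rw [hc]
    have := hr y
    simp only [sphereEval, map_mul, map_pow, eval_C] at this ⊢
    rw [this]; simp
  have hcN : c * sphI (n+2) 1 = N := by
    have h2 : sphI (n+2) (∑ i, e i * e i) = N := by
      rw [sphI_sum]; simp [h1]
    rw [← h2]
    simp only [sphI, hc']
    rw [← integral_const_mul]
    simp [sphereEval]
  obtain ⟨hP1, hP2⟩ := hb P hP
  have hcs : sphereEval P y ^ 2 ≤ sphI (n+2) (P * P) * c := by
    rw [← hc' y, ← hP2]
    have : sphereEval P y = ∑ i, sphI (n+2) (e i * P) * sphereEval (e i) y := by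
      conv_lhs => rw [hP1]
      simp [sphereEval]
    rw [this]
    have h3 : sphereEval (∑ i, e i * e i) y = ∑ i, sphereEval (e i) y ^ 2 := by
      simp [sphereEval, sq]
    rw [h3]
    exact Finset.sum_mul_sq_le_sq_mul_sq _ _ _
  have hI1 : 0 ≤ sphI (n+2) 1 := integral_nonneg fun y => by simp [sphereEval]
  have hIP : 0 ≤ sphI (n+2) (P * P) := by
    rw [← sphNormSq_eq]; exact integral_nonneg fun y => sq_nonneg _
  calc sphI (n+2) 1 * sphereEval P y ^ 2 ≤ sphI (n+2) 1 * (sphI (n+2) (P * P) * c) := by gcongr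
    _ = N * sphI (n+2) (P * P) := by rw [← hcN]; ring
    _ ≤ _ := by
      gcongr
      exact_mod_cast hN

lemma sphI_one_pos (n : ℕ) : 0 < sphI (n+2) 1 := by
  refine lt_of_le_of_ne (integral_nonneg fun y => by simp [sphereEval]) fun h => ?_
  have := sphI_pos (d := n+2) (by omega) (isHomogeneous_one (Fin (n+2)) ℝ) (by rw [mul_one, ← h])
  exact one_ne_zero this


lemma schur_aux (K : ℕ) (R1 R2 : Finset ℕ) (x y : ℕ → ℝ) :
    ∑ j ∈ R1, ∑ l ∈ R2, (if j ≤ l + K ∧ l ≤ j + K then x j * y l else 0) ≤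
      (2 * K + 1) * (Real.sqrt (∑ j ∈ R1, x j ^ 2) * Real.sqrt (∑ l ∈ R2, y l ^ 2)) := by
  set F := (R1 ×ˢ R2).filter (fun z => z.1 ≤ z.2 + K ∧ z.2 ≤ z.1 + K) with hF
  have e0 : ∀ f : ℕ → ℕ → ℝ, ∑ j ∈ R1, ∑ l ∈ R2, (if j ≤ l + K ∧ l ≤ j + K then f j l else 0)
      = ∑ z ∈ F, f z.1 z.2 := by
    intro f
    rw [hF, Finset.sum_filter, Finset.sum_product]
  have hcard : ∀ (R : Finset ℕ) (j : ℕ), ((R.filter fun l => j ≤ l + K ∧ l ≤ j + K).card : ℝ) ≤ 2 * K + 1 := by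
    intro R j
    have : (R.filter fun l => j ≤ l + K ∧ l ≤ j + K) ⊆ Finset.Icc (j - K) (j + K) := by
      intro l hl
      simp only [Finset.mem_filter, Finset.mem_Icc] at hl ⊢
      omega
    have h2 := Finset.card_le_card this
    rw [Nat.card_Icc] at h2
    have : (R.filter fun l => j ≤ l + K ∧ l ≤ j + K).card ≤ 2 * K + 1 := by omega
    exact_mod_cast this
  have e1 : ∑ z ∈ F, x z.1 ^ 2 ≤ (2 * K + 1) * ∑ j ∈ R1, x j ^ 2 := by
    rw [← e0 (fun j l => x j ^ 2), Finset.mul_sum]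
    refine Finset.sum_le_sum fun j _ => ?_
    rw [← Finset.sum_filter, Finset.sum_const, nsmul_eq_mul]
    exact mul_le_mul_of_nonneg_right (hcard R2 j) (sq_nonneg _)
  have e2 : ∑ z ∈ F, y z.2 ^ 2 ≤ (2 * K + 1) * ∑ l ∈ R2, y l ^ 2 := by
    rw [← e0 (fun j l => y l ^ 2), Finset.mul_sum, Finset.sum_comm]
    refine Finset.sum_le_sum fun l _ => ?_
    rw [← Finset.sum_filter, Finset.sum_const, nsmul_eq_mul]
    refine mul_le_mul_of_nonneg_right ?_ (sq_nonneg _)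
    have := hcard R1 l
    simpa only [and_comm] using this
  rw [e0 (fun j l => x j * y l)]
  have cs := Finset.sum_mul_sq_le_sq_mul_sq F (fun z => x z.1) (fun z => y z.2)
  have hx : 0 ≤ ∑ j ∈ R1, x j ^ 2 := Finset.sum_nonneg fun _ _ => sq_nonneg _
  have hy : 0 ≤ ∑ l ∈ R2, y l ^ 2 := Finset.sum_nonneg fun _ _ => sq_nonneg _
  refine (le_abs_self _).trans (abs_le_of_sq_le_sq ?_ (by positivity))
  calc _ ≤ _ := cs
    _ ≤ ((2 * K + 1) * ∑ j ∈ R1, x j ^ 2) * ((2 * K + 1) * ∑ l ∈ R2, y l ^ 2) :=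
      mul_le_mul e1 e2 (Finset.sum_nonneg fun _ _ => sq_nonneg _) (by positivity)
    _ = _ := by rw [mul_pow, mul_pow, Real.sq_sqrt hx, Real.sq_sqrt hy]; ring

lemma half_sum (R Q : Finset ℕ) (a x y z : ℕ → ℝ) (D : ℝ) (hD : 0 ≤ D) (ha : ∀ k, 0 ≤ a k)
    (hz : ∀ k, 0 ≤ z k)
    (hsum : ∑ k ∈ R, ((2 * k + 1) * a k) ^ 2 ≤ D ^ 2) :
    ∑ k ∈ R, ∑ j ∈ R, ∑ l ∈ Q, (if j ≤ l + k ∧ l ≤ j + k then a k * z k * (x j * y l) else 0) ≤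
      D * Real.sqrt (∑ k ∈ R, z k ^ 2) * (Real.sqrt (∑ j ∈ R, x j ^ 2) * Real.sqrt (∑ l ∈ Q, y l ^ 2)) := by
  set X := Real.sqrt (∑ j ∈ R, x j ^ 2)
  set Y := Real.sqrt (∑ l ∈ Q, y l ^ 2)
  have hXY : 0 ≤ X * Y := by positivity
  have h1 : ∀ k ∈ R, ∑ j ∈ R, ∑ l ∈ Q, (if j ≤ l + k ∧ l ≤ j + k then a k * z k * (x j * y l) else 0) ≤
      ((2 * k + 1) * a k) * z k * (X * Y) := by
    intro k _
    have e : ∑ j ∈ R, ∑ l ∈ Q, (if j ≤ l + k ∧ l ≤ j + k then a k * z k * (x j * y l) else 0) =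
        a k * z k * ∑ j ∈ R, ∑ l ∈ Q, (if j ≤ l + k ∧ l ≤ j + k then (x j * y l) else 0) := by
      simp only [Finset.mul_sum, mul_ite, mul_zero]
    rw [e]
    have := mul_le_mul_of_nonneg_left (schur_aux k R Q x y) (mul_nonneg (ha k) (hz k))
    refine this.trans (le_of_eq ?_)
    ring
  refine (Finset.sum_le_sum h1).trans ?_
  rw [← Finset.sum_mul]
  refine mul_le_mul_of_nonneg_right ?_ hXY
  have cs := Real.sum_mul_le_sqrt_mul_sqrt R (fun k => (2 * k + 1) * a k) z
  refine cs.trans (mul_le_mul_of_nonneg_right ?_ (Real.sqrt_nonneg _))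
  exact (Real.sqrt_le_sqrt hsum).trans (by rw [Real.sqrt_sq hD])

lemma weights (s t : ℝ) (hs : 0 ≤ s) (ht : 0 ≤ t) (j k l : ℕ) (hkj : k ≤ j) (hl : l ≤ j + k) :
    (1 + (l:ℝ)^2)^(s/2) * Real.exp (l * t) ≤
      4 ^ (s/2) * ((1 + (j:ℝ)^2)^(s/2) * Real.exp (j * t)) * Real.exp (k * t) := by
  have hkj' : (k:ℝ) ≤ j := by exact_mod_cast hkj
  have hl' : (l:ℝ) ≤ j + k := by exact_mod_cast hl
  have h0 : (0:ℝ) ≤ l := Nat.cast_nonneg _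
  have h1 : (1 + (l:ℝ)^2)^(s/2) ≤ 4 ^ (s/2) * (1 + (j:ℝ)^2)^(s/2) := by
    rw [← Real.mul_rpow (by norm_num) (by positivity)]
    apply Real.rpow_le_rpow (by positivity) _ (by linarith)
    nlinarith
  have h2 : Real.exp (l * t) ≤ Real.exp (j * t) * Real.exp (k * t) := by
    rw [← Real.exp_add]
    apply Real.exp_le_exp.2
    nlinarith
  calc _ ≤ (4 ^ (s/2) * (1 + (j:ℝ)^2)^(s/2)) * (Real.exp (j * t) * Real.exp (k * t)) := by gcongr
    _ = _ := by ring

lemma combin (s t : ℝ) (hs : 0 ≤ s) (ht : 0 ≤ t) (R Q : Finset ℕ) (M U V W : ℕ → ℝ)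
    (T : ℕ → ℕ → ℕ → ℝ) (D : ℝ) (hD : 0 ≤ D) (hM : ∀ k, 0 ≤ M k)
    (hU : ∀ k, 0 ≤ U k) (hV : ∀ k, 0 ≤ V k) (hW : ∀ k, 0 ≤ W k)
    (hsum : ∑ k ∈ R, ((2 * k + 1) * (M k * (1 + (k:ℝ)^2)^(-(s/2)))) ^ 2 ≤ D ^ 2)
    (h1 : ∀ j ∈ R, ∀ k ∈ R, ∀ l ∈ Q, T j k l ≤ M k * V k * (U j * W l))
    (h2 : ∀ j ∈ R, ∀ k ∈ R, ∀ l ∈ Q, T j k l ≤ M j * U j * (V k * W l))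
    (h0 : ∀ j ∈ R, ∀ k ∈ R, ∀ l ∈ Q, ¬ (l ≤ j + k ∧ j ≤ l + k ∧ k ≤ l + j) → T j k l = 0)
    (hw : ∀ l ∈ Q, W l ^ 2 = ∑ j ∈ R, ∑ k ∈ R, T j k l) :
    ∑ l ∈ Q, ((1 + (l:ℝ)^2)^(s/2) * Real.exp (l * t) * W l) ^ 2 ≤
      (2 * 4 ^ (s/2) * D) ^ 2 * (∑ l ∈ R, ((1 + (l:ℝ)^2)^(s/2) * Real.exp (l * t) * U l) ^ 2) *
        ∑ l ∈ R, ((1 + (l:ℝ)^2)^(s/2) * Real.exp (l * t) * V l) ^ 2 := by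
  set p : ℕ → ℝ := fun l => (1 + (l:ℝ)^2)^(s/2) * Real.exp (l * t) with hp
  set a : ℕ → ℝ := fun k => M k * (1 + (k:ℝ)^2)^(-(s/2)) with ha
  have hp0 : ∀ l, 0 ≤ p l := fun l => by positivity
  have ha0 : ∀ l, 0 ≤ a l := fun l => mul_nonneg (hM l) (by positivity)
  have hap : ∀ k, a k * p k = M k * Real.exp (k * t) := by
    intro k
    simp only [ha, hp]
    have : (1 + (k:ℝ)^2)^(-(s/2)) * (1 + (k:ℝ)^2)^(s/2) = 1 := by
      rw [← Real.rpow_add (by positivity)]; simp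
    linear_combination M k * Real.exp (k * t) * this
  set K : ℝ := 4 ^ (s/2) with hK
  have hK0 : 0 ≤ K := by positivity
  set x : ℕ → ℝ := fun l => p l * U l with hx
  set z : ℕ → ℝ := fun l => p l * V l with hz
  set y : ℕ → ℝ := fun l => p l * W l with hy
  have hx0 : ∀ l, 0 ≤ x l := fun l => mul_nonneg (hp0 l) (hU l)
  have hz0 : ∀ l, 0 ≤ z l := fun l => mul_nonneg (hp0 l) (hV l)
  have hy0 : ∀ l, 0 ≤ y l := fun l => mul_nonneg (hp0 l) (hW l)
  have key : ∀ j ∈ R, ∀ k ∈ R, ∀ l ∈ Q, p l ^ 2 * T j k l ≤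
      K * (if j ≤ l + k ∧ l ≤ j + k then a k * z k * (x j * y l) else 0) +
      K * (if k ≤ l + j ∧ l ≤ k + j then a j * x j * (z k * y l) else 0) := by
    intro j hj k hk l hl
    have n1 : 0 ≤ a k * z k * (x j * y l) :=
      mul_nonneg (mul_nonneg (ha0 _) (hz0 _)) (mul_nonneg (hx0 _) (hy0 _))
    have n2 : 0 ≤ a j * x j * (z k * y l) :=
      mul_nonneg (mul_nonneg (ha0 _) (hx0 _)) (mul_nonneg (hz0 _) (hy0 _))
    by_cases hc : l ≤ j + k ∧ j ≤ l + k ∧ k ≤ l + j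
    · rw [if_pos (by omega), if_pos (by omega)]
      rcases le_total k j with hkj | hjk
      · have w1 := weights s t hs ht j k l hkj hc.1
        change p l ≤ K * p j * Real.exp (k * t) at w1
        have : p l ^ 2 * T j k l ≤ K * (a k * z k * (x j * y l)) := by
          calc p l ^ 2 * T j k l ≤ p l ^ 2 * (M k * V k * (U j * W l)) := by
                gcongr; exact h1 j hj k hk l hl
            _ = p l * (p l * (M k * V k * (U j * W l))) := by ring
            _ ≤ (K * p j * Real.exp (k * t)) * (p l * (M k * V k * (U j * W l))) := by
                apply mul_le_mul_of_nonneg_right w1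
                exact mul_nonneg (hp0 _) (mul_nonneg (mul_nonneg (hM _) (hV _)) (mul_nonneg (hU _) (hW _)))
            _ = K * ((M k * Real.exp (k * t)) * V k * (p j * U j * (p l * W l))) := by ring
            _ = K * (a k * z k * (x j * y l)) := by rw [← hap]; simp only [hx, hy, hz]; ring
        have := mul_nonneg hK0 n2
        linarith
      · have w1 := weights s t hs ht k j l hjk (by omega)
        change p l ≤ K * p k * Real.exp (j * t) at w1
        have : p l ^ 2 * T j k l ≤ K * (a j * x j * (z k * y l)) := by
          calc p l ^ 2 * T j k l ≤ p l ^ 2 * (M j * U j * (V k * W l)) := by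
                gcongr; exact h2 j hj k hk l hl
            _ = p l * (p l * (M j * U j * (V k * W l))) := by ring
            _ ≤ (K * p k * Real.exp (j * t)) * (p l * (M j * U j * (V k * W l))) := by
                apply mul_le_mul_of_nonneg_right w1
                exact mul_nonneg (hp0 _) (mul_nonneg (mul_nonneg (hM _) (hU _)) (mul_nonneg (hV _) (hW _)))
            _ = K * ((M j * Real.exp (j * t)) * U j * (p k * V k * (p l * W l))) := by ring
            _ = K * (a j * x j * (z k * y l)) := by rw [← hap]; simp only [hx, hy, hz]; ring
        have := mul_nonneg hK0 n1
        linarith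
    · rw [h0 j hj k hk l hl hc, mul_zero]
      refine add_nonneg (mul_nonneg hK0 ?_) (mul_nonneg hK0 ?_) <;> split_ifs <;> first | assumption | exact le_rfl
  have s1 := half_sum R Q a x y z D hD ha0 hz0 hsum
  have s2 := half_sum R Q a z y x D hD ha0 hx0 hsum
  set X := Real.sqrt (∑ j ∈ R, x j ^ 2) with hX
  set Y := Real.sqrt (∑ l ∈ Q, y l ^ 2) with hY
  set Z := Real.sqrt (∑ l ∈ R, z l ^ 2) with hZ
  have tot : ∑ l ∈ Q, y l ^ 2 ≤ 2 * K * D * X * Z * Y := by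
    calc ∑ l ∈ Q, y l ^ 2 = ∑ l ∈ Q, ∑ j ∈ R, ∑ k ∈ R, p l ^ 2 * T j k l := by
          refine Finset.sum_congr rfl fun l hl => ?_
          simp only [hy, mul_pow, hw l hl, Finset.mul_sum]
      _ ≤ ∑ l ∈ Q, ∑ j ∈ R, ∑ k ∈ R,
          (K * (if j ≤ l + k ∧ l ≤ j + k then a k * z k * (x j * y l) else 0) +
      K * (if k ≤ l + j ∧ l ≤ k + j then a j * x j * (z k * y l) else 0)) :=
          Finset.sum_le_sum fun l hl => Finset.sum_le_sum fun j hj => Finset.sum_le_sum fun k hk =>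
            key j hj k hk l hl
      _ = K * (∑ k ∈ R, ∑ j ∈ R, ∑ l ∈ Q, (if j ≤ l + k ∧ l ≤ j + k then a k * z k * (x j * y l) else 0))
         + K * (∑ j ∈ R, ∑ k ∈ R, ∑ l ∈ Q, (if k ≤ l + j ∧ l ≤ k + j then a j * x j * (z k * y l) else 0)) := by
          simp only [Finset.sum_add_distrib, ← Finset.mul_sum]
          have sw : ∀ f : ℕ → ℕ → ℕ → ℝ, ∑ l ∈ Q, ∑ j ∈ R, ∑ k ∈ R, f l j k =
              ∑ j ∈ R, ∑ k ∈ R, ∑ l ∈ Q, f l j k := by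
            intro f
            rw [Finset.sum_comm]
            exact Finset.sum_congr rfl fun j _ => Finset.sum_comm
          rw [sw, sw]
          congr 2
          rw [Finset.sum_comm]
      _ ≤ K * (D * Z * (X * Y)) + K * (D * X * (Z * Y)) := by gcongr
      _ = _ := by ring
  have hYsq : ∑ l ∈ Q, y l ^ 2 = Y ^ 2 := (Real.sq_sqrt (Finset.sum_nonneg fun _ _ => sq_nonneg _)).symm
  have hXsq : ∑ l ∈ R, x l ^ 2 = X ^ 2 := (Real.sq_sqrt (Finset.sum_nonneg fun _ _ => sq_nonneg _)).symm
  have hZsq : ∑ l ∈ R, z l ^ 2 = Z ^ 2 := (Real.sq_sqrt (Finset.sum_nonneg fun _ _ => sq_nonneg _)).symm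
  have hY0 : 0 ≤ Y := Real.sqrt_nonneg _
  have hX0 : 0 ≤ X := Real.sqrt_nonneg _
  have hZ0 : 0 ≤ Z := Real.sqrt_nonneg _
  change ∑ l ∈ Q, y l ^ 2 ≤ _ * (∑ l ∈ R, x l ^ 2) * (∑ l ∈ R, z l ^ 2)
  rw [hYsq] at tot
  rw [hYsq, hXsq, hZsq]
  have hle : Y ≤ 2 * K * D * X * Z := by
    rcases hY0.eq_or_lt with h | h
    · rw [← h]; positivity
    · rw [sq] at tot
      exact le_of_mul_le_mul_right tot h
  calc Y ^ 2 ≤ (2 * K * D * X * Z) ^ 2 := by gcongr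
    _ = _ := by ring

lemma D_exists (n : ℕ) (s B : ℝ) (hs : ((n:ℝ)+2)/2 + 1/2 < s) : ∃ D : ℝ, 0 < D ∧ ∀ R : Finset ℕ,
    ∑ k ∈ R, ((2 * k + 1) * ((B * Real.sqrt ((k+1)^n)) * (1 + (k:ℝ)^2)^(-(s/2)))) ^ 2 ≤ D ^ 2 := by
  have hn : (0:ℝ) ≤ n := Nat.cast_nonneg _
  have hsm : Summable (fun k : ℕ => ((2 * k + 1) * ((B * Real.sqrt ((k+1)^n)) * (1 + (k:ℝ)^2)^(-(s/2)))) ^ 2) := by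
    have h1 : Summable (fun k : ℕ => ((k:ℝ)) ^ ((n:ℝ) + 2 - 2 * s)) :=
      Real.summable_nat_rpow.2 (by linarith)
    have h2 := (((summable_nat_add_iff 1).2 h1).mul_left (4 * B ^ 2 * 2 ^ s))
    refine Summable.of_nonneg_of_le (fun k => sq_nonneg _) (fun k => ?_) h2
    have hk : (0:ℝ) ≤ k := Nat.cast_nonneg _
    have e1 : ((1 + (k:ℝ)^2)^(-(s/2))) ^ 2 = (1 + (k:ℝ)^2)^(-s) := by
      rw [← Real.rpow_natCast, ← Real.rpow_mul (by positivity)]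
      congr 1; push_cast; ring
    have e2 : (1 + (k:ℝ)^2)^(-s) ≤ 2 ^ s * ((k:ℝ)+1) ^ (-(2 * s)) := by
      have : (2:ℝ) ^ s * ((k:ℝ)+1) ^ (-(2 * s)) = (((k:ℝ)+1)^2 / 2) ^ (-s) := by
        rw [Real.div_rpow (by positivity) (by norm_num), ← Real.rpow_natCast ((k:ℝ)+1) 2,
          ← Real.rpow_mul (by positivity), Real.rpow_neg (by norm_num : (0:ℝ) ≤ 2), div_inv_eq_mul, mul_comm]
        congr 2; push_cast; ring
      rw [this]
      apply Real.rpow_le_rpow_of_nonpos (by positivity) _ (by linarith)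
      nlinarith [sq_nonneg ((k:ℝ)-1)]
    have e3 : (((k+1:ℕ):ℝ)) ^ ((n:ℝ) + 2 - 2 * s) = ((k:ℝ)+1)^n * ((k:ℝ)+1)^2 * ((k:ℝ)+1) ^ (-(2 * s)) := by
      push_cast
      rw [← Real.rpow_natCast _ n, ← Real.rpow_natCast _ 2, ← Real.rpow_add (by positivity),
        ← Real.rpow_add (by positivity)]
      congr 1
    rw [e3, mul_pow, mul_pow, mul_pow, e1, Real.sq_sqrt (by positivity)]
    calc (2 * (k:ℝ) + 1)^2 * (B^2 * (k+1)^n * (1 + (k:ℝ)^2)^(-s))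
        ≤ (4 * ((k:ℝ)+1)^2) * (B^2 * (k+1)^n * (2 ^ s * ((k:ℝ)+1) ^ (-(2 * s)))) := by
          gcongr
          nlinarith
      _ = _ := by ring
  refine ⟨Real.sqrt (∑' k : ℕ, ((2 * k + 1) * ((B * Real.sqrt ((k+1)^n)) * (1 + (k:ℝ)^2)^(-(s/2)))) ^ 2) + 1,
    by positivity, fun R => ?_⟩
  have h3 := hsm.sum_le_tsum R (fun k _ => sq_nonneg _)
  refine h3.trans ?_
  have h4 : 0 ≤ ∑' k : ℕ, ((2 * k + 1) * ((B * Real.sqrt ((k+1)^n)) * (1 + (k:ℝ)^2)^(-(s/2)))) ^ 2 :=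
    tsum_nonneg fun k => sq_nonneg _
  nlinarith [Real.sq_sqrt h4, Real.sqrt_nonneg (∑' k : ℕ, ((2 * k + 1) * ((B * Real.sqrt ((k+1)^n)) * (1 + (k:ℝ)^2)^(-(s/2)))) ^ 2)]


lemma sphNormSq_nonneg {d : ℕ} (p : MvPolynomial (Fin d) ℝ) : 0 ≤ sphNormSq d p :=
  integral_nonneg fun y => sq_nonneg _

lemma sup_bound' (n k : ℕ) {P : MvPolynomial (Fin (n+2)) ℝ} (hP : IsHarmHom (n+2) P k)
    (y : Metric.sphere (0 : EuclideanSpace ℝ (Fin (n+2))) 1) :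
    |sphereEval P y| ≤ (Real.sqrt (2 / sphI (n+2) 1) * Real.sqrt (((k:ℝ)+1)^n)) *
      Real.sqrt (sphNormSq (n+2) P) := by
  have h := sup_bound n k hP y
  have h1 := sphI_one_pos n
  refine abs_le_of_sq_le_sq ?_ (by positivity)
  rw [mul_pow, mul_pow, Real.sq_sqrt (by positivity), Real.sq_sqrt (by positivity),
    Real.sq_sqrt (sphNormSq_nonneg P), sphNormSq_eq]
  have : 2 / sphI (n+2) 1 * ((k:ℝ)+1)^n * sphI (n+2) (P * P) =
      (2 * ((k:ℝ)+1)^n * sphI (n+2) (P * P)) / sphI (n+2) 1 := by ring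
  rw [this, le_div_iff₀ h1]
  linarith

lemma cs_int {d : ℕ} (p q : MvPolynomial (Fin d) ℝ) :
    ∫ y, |sphereEval p y| * |sphereEval q y| ∂(sphereMeasure d) ≤
      Real.sqrt (sphNormSq d p) * Real.sqrt (sphNormSq d q) := by
  have hm : ∀ p : MvPolynomial (Fin d) ℝ, MemLp (sphereEval p) (ENNReal.ofReal 2) (sphereMeasure d) :=
    fun p => (sphereEval_continuous p).memLp_of_hasCompactSupport (HasCompactSupport.of_compactSpace _)
  have := integral_mul_norm_le_Lp_mul_Lq Real.HolderConjugate.two_two (hm p) (hm q)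
  simp only [Real.norm_eq_abs, Real.rpow_two, sq_abs, ← Real.sqrt_eq_rpow] at this
  exact this

lemma triple_bound (n k : ℕ) {P : MvPolynomial (Fin (n+2)) ℝ} (hP : IsHarmHom (n+2) P k)
    (p q : MvPolynomial (Fin (n+2)) ℝ) :
    sphI (n+2) (P * (p * q)) ≤ (Real.sqrt (2 / sphI (n+2) 1) * Real.sqrt (((k:ℝ)+1)^n)) *
      Real.sqrt (sphNormSq (n+2) P) * (Real.sqrt (sphNormSq (n+2) p) * Real.sqrt (sphNormSq (n+2) q)) := by
  set c := (Real.sqrt (2 / sphI (n+2) 1) * Real.sqrt (((k:ℝ)+1)^n)) * Real.sqrt (sphNormSq (n+2) P) with hc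
  have hc0 : 0 ≤ c := by positivity
  calc sphI (n+2) (P * (p * q)) ≤ ∫ y, c * (|sphereEval p y| * |sphereEval q y|) ∂(sphereMeasure (n+2)) := by
        unfold sphI
        refine integral_mono (sphere_integrable (sphereEval_continuous _)) (sphere_integrable ?_) fun y => ?_
        · have := sphereEval_continuous p
          have := sphereEval_continuous q
          fun_prop
        · have e : sphereEval (P * (p * q)) y = sphereEval P y * (sphereEval p y * sphereEval q y) := by
            simp [sphereEval]
          simp only [e]
          refine (le_abs_self _).trans ?_
          rw [abs_mul, abs_mul]
          exact mul_le_mul_of_nonneg_right (sup_bound' n k hP y) (by positivity)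
    _ = c * ∫ y, (|sphereEval p y| * |sphereEval q y|) ∂(sphereMeasure (n+2)) := integral_const_mul _ _
    _ ≤ _ := mul_le_mul_of_nonneg_left (cs_int p q) hc0

theorem stmt2 (d : ℕ) (hd : 2 ≤ d) (s : ℝ) (hs : (d : ℝ) / 2 + 1 / 2 < s) :
    ∃ C : ℝ, 0 < C ∧
      ∀ t : ℝ, 0 ≤ t →
      ∀ (L : ℕ) (u v w : ℕ → MvPolynomial (Fin d) ℝ),
        (∀ ℓ ≤ L, IsHarmHom d (u ℓ) ℓ) →
        (∀ ℓ ≤ L, IsHarmHom d (v ℓ) ℓ) →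
        (∀ ℓ ≤ 2 * L, IsHarmHom d (w ℓ) ℓ) →
        (∀ y : Metric.sphere (0 : EuclideanSpace ℝ (Fin d)) 1,
          (∑ ℓ ∈ Finset.range (L + 1), sphereEval (u ℓ) y) *
            (∑ ℓ ∈ Finset.range (L + 1), sphereEval (v ℓ) y)
            = ∑ ℓ ∈ Finset.range (2 * L + 1), sphereEval (w ℓ) y) →
        ∑ ℓ ∈ Finset.range (2 * L + 1),
            (1 + (ℓ : ℝ) ^ 2) ^ s * Real.exp (2 * ((ℓ : ℝ) + ((d : ℝ) - 2) / 2) * t) *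
              sphNormSq d (w ℓ)
          ≤ C ^ 2 * Real.exp (-((d : ℝ) - 2) * t) *
            (∑ ℓ ∈ Finset.range (L + 1),
              (1 + (ℓ : ℝ) ^ 2) ^ s * Real.exp (2 * ((ℓ : ℝ) + ((d : ℝ) - 2) / 2) * t) *
                sphNormSq d (u ℓ)) *
            (∑ ℓ ∈ Finset.range (L + 1),
              (1 + (ℓ : ℝ) ^ 2) ^ s * Real.exp (2 * ((ℓ : ℝ) + ((d : ℝ) - 2) / 2) * t) *
                sphNormSq d (v ℓ)) := by
  obtain ⟨n, rfl⟩ : ∃ n, d = n + 2 := ⟨d - 2, by omega⟩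
  have hn : (0:ℝ) ≤ n := Nat.cast_nonneg _
  push_cast at hs
  have hs0 : 0 ≤ s := by linarith
  set B := Real.sqrt (2 / sphI (n+2) 1) with hB
  obtain ⟨D, hD, hsum⟩ := D_exists n s B hs
  refine ⟨2 * 4 ^ (s/2) * D, by positivity, ?_⟩
  intro t ht L u v w hu hv hw heq
  have horth : ∀ l ≤ 2 * L, ∀ l' ≤ 2 * L, l' ≠ l → sphI (n+2) (w l * w l') = 0 := by
    intro l hl l' hl' hne
    rcases Nat.lt_or_gt_of_ne hne with h | h
    · exact harm_orth hd l' l _ _ (hw l hl) (hw l' hl').1 h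
    · rw [mul_comm]
      exact harm_orth hd l l' _ _ (hw l' hl') (hw l hl).1 h
  have main := combin s t hs0 ht (Finset.range (L+1)) (Finset.range (2 * L + 1))
    (fun k => B * Real.sqrt (((k:ℝ)+1)^n))
    (fun l => Real.sqrt (sphNormSq (n+2) (u l))) (fun l => Real.sqrt (sphNormSq (n+2) (v l)))
    (fun l => Real.sqrt (sphNormSq (n+2) (w l))) (fun j k l => sphI (n+2) (u j * v k * w l)) D hD.le
    (fun k => by positivity) (fun k => by positivity) (fun k => by positivity) (fun k => by positivity)
    (hsum _) ?_ ?_ ?_ ?_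
  · have conv : ∀ (l : ℕ) (p : MvPolynomial (Fin (n+2)) ℝ),
        (1 + (l : ℝ) ^ 2) ^ s * Real.exp (2 * ((l : ℝ) + (((n+2 : ℕ) : ℝ) - 2) / 2) * t) * sphNormSq (n+2) p
        = Real.exp (n * t) *
          ((1 + (l:ℝ)^2)^(s/2) * Real.exp (l * t) * Real.sqrt (sphNormSq (n+2) p)) ^ 2 := by
      intro l p
      have e0 : ((1 + (l:ℝ)^2)^(s/2))^2 = (1 + (l:ℝ)^2)^s := by
        rw [← Real.rpow_natCast ((1 + (l:ℝ)^2)^(s/2)) 2, ← Real.rpow_mul (by positivity)]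
        congr 1; push_cast; ring
      rw [mul_pow, mul_pow, Real.sq_sqrt (sphNormSq_nonneg p), e0, ← Real.exp_nat_mul]
      have e2 : Real.exp (2 * ((l : ℝ) + (((n+2 : ℕ) : ℝ) - 2) / 2) * t) =
          Real.exp (n * t) * Real.exp (((2:ℕ):ℝ) * (l * t)) := by
        rw [← Real.exp_add]; congr 1; push_cast; ring
      rw [e2]; ring
    simp only [conv, ← Finset.mul_sum]
    have e3 : Real.exp (-(((n+2 : ℕ) : ℝ) - 2) * t) * Real.exp (n * t) = 1 := by
      rw [← Real.exp_add, ← Real.exp_zero]; congr 1; push_cast; ring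
    calc _ ≤ Real.exp (n * t) * _ := mul_le_mul_of_nonneg_left main (Real.exp_pos _).le
      _ = _ := by
        generalize (∑ l ∈ Finset.range (L+1), ((1 + (l:ℝ)^2)^(s/2) * Real.exp (l * t) * Real.sqrt (sphNormSq (n+2) (u l))) ^ 2) = X
        generalize (∑ l ∈ Finset.range (L+1), ((1 + (l:ℝ)^2)^(s/2) * Real.exp (l * t) * Real.sqrt (sphNormSq (n+2) (v l))) ^ 2) = Y
        linear_combination (-(Real.exp (n * t) * (2 * 4 ^ (s/2) * D) ^ 2 * X * Y)) * e3
  · intro j hj k hk l hl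
    rw [Finset.mem_range] at hj hk hl
    have := triple_bound n k (hv k (by omega)) (u j) (w l)
    rwa [← mul_assoc, mul_comm (v k)] at this
  · intro j hj k hk l hl
    rw [Finset.mem_range] at hj hk hl
    have := triple_bound n j (hu j (by omega)) (v k) (w l)
    rwa [← mul_assoc] at this
  · intro j hj k hk l hl hc
    rw [Finset.mem_range] at hj hk hl
    have Hu := hu j (by omega)
    have Hv := hv k (by omega)
    have Hw := hw l (by omega)
    by_cases c1 : l ≤ j + k
    · by_cases c2 : j ≤ l + k
      · have := harm_orth hd (j + l) k _ _ Hv (Hu.1.mul Hw.1) (by omega)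
        rw [← this]; congr 1; ring
      · have := harm_orth hd (k + l) j _ _ Hu (Hv.1.mul Hw.1) (by omega)
        rw [← this]; congr 1; ring
    · have := harm_orth hd (j + k) l _ _ Hw (Hu.1.mul Hv.1) (by omega)
      rw [← this]; congr 1; ring
  · intro l hl
    rw [Finset.mem_range] at hl
    rw [Real.sq_sqrt (sphNormSq_nonneg _), sphNormSq_eq]
    have e1 : sphI (n+2) (w l * w l) = ∑ l' ∈ Finset.range (2 * L + 1), sphI (n+2) (w l * w l') := by
      rw [Finset.sum_eq_single l]
      · intro l' hl' hne
        rw [Finset.mem_range] at hl'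
        exact horth l (by omega) l' (by omega) hne
      · intro h; exact absurd (Finset.mem_range.2 hl) h
    rw [e1, ← sphI_sum, ← Finset.mul_sum]
    simp only [← sphI_sum]
    unfold sphI
    congr 1
    funext y
    have hy := heq y
    simp only [sphereEval, map_mul, map_sum] at hy ⊢
    rw [← hy, Finset.sum_mul_sum, Finset.mul_sum]
    refine Finset.sum_congr rfl fun j _ => ?_
    rw [Finset.mul_sum]
    refine Finset.sum_congr rfl fun k _ => ?_
    ring
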